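/- Let n ≥ 1, m ≥ 1, let a₁,…,a_m be constants with each aᵢ > 1, set a = Σᵢ₌₁ᵐ aᵢ, and let 1 < α < (n+2a+2)/(n+2a-2). Suppose u : ℝⁿ × [0,∞)ᵐ → ℝ is nonnegative, of class C² up to the boundary, and satisfies Σᵢ₌₁ᵐ yᵢ·∂²u/∂yᵢ² + Σᵢ₌₁ᵐ aᵢ·∂u/∂yᵢ + Δₓu + u^α = 0 at every point with all yᵢ > 0. Then u ≡ 0. -/

import Mathlib

set_option linter.unusedSectionVars false
/-- Second partial derivative in the `i`-th `x`-variable. -/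
noncomputable def pdxx (n m : ℕ) (u : (Fin n → ℝ) × (Fin m → ℝ) → ℝ) (i : Fin n)
    (x : Fin n → ℝ) (y : Fin m → ℝ) : ℝ :=
  deriv (fun t => deriv (fun s => u (Function.update x i s, y)) t) (x i)

/-- First partial derivative in the `i`-th `y`-variable. -/
noncomputable def pdy (n m : ℕ) (u : (Fin n → ℝ) × (Fin m → ℝ) → ℝ) (i : Fin m)
    (x : Fin n → ℝ) (y : Fin m → ℝ) : ℝ :=
  deriv (fun t => u (x, Function.update y i t)) (y i)

/-- Second partial derivative in the `i`-th `y`-variable. -/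
noncomputable def pdyy (n m : ℕ) (u : (Fin n → ℝ) × (Fin m → ℝ) → ℝ) (i : Fin m)
    (x : Fin n → ℝ) (y : Fin m → ℝ) : ℝ :=
  deriv (fun t => deriv (fun s => u (x, Function.update y i s)) t) (y i)


lemma lv_min_test {f f' : ℝ → ℝ} {c t : ℝ} (hf : ∀ s, HasDerivAt f (f' s) s)
    (hf' : HasDerivAt f' c t) (hmin : IsLocalMin f t) : f' t = 0 ∧ 0 ≤ c := by
  have h0 : f' t = 0 := hmin.hasDerivAt_eq_zero (hf t)
  have hd : deriv f = f' := funext fun s => (hf s).deriv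
  refine ⟨h0, ?_⟩
  by_contra hc
  push Not at hc
  have hmax : IsLocalMax f t := by
    apply isLocalMax_of_deriv_deriv_neg
    · rw [hd, hf'.deriv]; exact hc
    · rw [hd, h0]
    · exact (hf t).continuousAt
  have hconst : f =ᶠ[nhds t] fun _ => f t := by
    filter_upwards [hmin, hmax] with s h1 h2
    exact le_antisymm h2 h1
  have h1 : deriv f =ᶠ[nhds t] fun _ => 0 := by
    have := hconst.deriv
    simpa using this
  rw [hd] at h1
  have h2 := h1.deriv_eq
  rw [hf'.deriv] at h2
  simp at h2
  linarith

lemma lv_convex {α x y : ℝ} (hα : 1 < α) (hx : 0 < x) (hy : 0 < y) :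
    α * y ^ (α - 1) * (x - y) ≤ x ^ α - y ^ α := by
  have h := one_add_mul_self_le_rpow_one_add (s := x / y - 1) (by
    have : 0 < x / y := by positivity
    linarith) hα.le
  have h1 : (1 + (x / y - 1)) = x / y := by ring
  rw [h1, Real.div_rpow hx.le hy.le] at h
  have hyα : 0 < y ^ α := by positivity
  have h2 : y ^ (α - 1) = y ^ α / y := by
    rw [Real.rpow_sub hy, Real.rpow_one]
  rw [h2]
  rw [le_div_iff₀ hyα] at h
  have : α * (y ^ α / y) * (x - y) = (1 + α * (x / y - 1)) * y ^ α - y ^ α := by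
    field_simp
    ring
  linarith

section cyl
variable {E : Type*} [TopologicalSpace E] {S : Set E} {V V1 V2 : ℝ → E → ℝ} {κ δ α : ℝ}

/-- comparison lemma -/
lemma lv_comp (hS : IsCompact S) (hα : 1 < α) (hδ : 0 < δ)
    (hVc : Continuous (fun p : ℝ × E => V p.1 p.2))
    (hV1 : ∀ t θ, HasDerivAt (fun s => V s θ) (V1 t θ) t)
    (hV2 : ∀ t θ, HasDerivAt (fun s => V1 s θ) (V2 t θ) t)
    (hpos : ∀ t, ∀ θ ∈ S, 0 < V t θ)
    (hstar : ∀ A B t t' : ℝ, ∀ θ ∈ S,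
      (∀ θ' ∈ S, A * V t' θ - B * V t θ ≤ A * V t' θ' - B * V t θ') →
      A * (V2 t' θ - κ ^ 2 * V t' θ + Real.exp (δ * t') * V t' θ ^ α)
        - B * (V2 t θ - κ ^ 2 * V t θ + Real.exp (δ * t) * V t θ ^ α) ≤ 0)
    (p q τ M tc ε : ℝ) (hqτ : q ≤ τ) (hε : 0 ≤ ε)
    (hM : ∀ t ∈ Set.Icc p q, |M * (t - tc)| ≤ 1)
    (hC : ∀ t ∈ Set.Icc p q, ∀ θ ∈ S, α * Real.exp (δ * t) * V t θ ^ (α - 1) < M ^ 2 + κ ^ 2)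
    (hp : ∀ θ ∈ S, -ε * Real.cos (M * (p - tc)) ≤ V (2 * τ - p) θ - V p θ)
    (hq : ∀ θ ∈ S, -ε * Real.cos (M * (q - tc)) ≤ V (2 * τ - q) θ - V q θ) :
    ∀ t ∈ Set.Icc p q, ∀ θ ∈ S,
      -ε * Real.cos (M * (t - tc)) ≤ V (2 * τ - t) θ - V t θ := by
  intro t1 ht1 θ1 hθ1
  by_contra hcon
  push Not at hcon
  set g : ℝ → ℝ := fun t => Real.cos (M * (t - tc)) with hg
  have hgpos : ∀ t ∈ Set.Icc p q, 0 < g t := by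
    intro t ht
    apply Real.cos_pos_of_mem_Ioo
    have := abs_le.1 (hM t ht)
    have := Real.pi_gt_three
    constructor <;> linarith
  set W : ℝ → E → ℝ := fun t θ => V (2 * τ - t) θ - V t θ with hW
  have hWc : Continuous (fun p : ℝ × E => W p.1 p.2) := by
    have h1 : Continuous (fun p : ℝ × E => V (2 * τ - p.1) p.2) :=
      hVc.comp (f := fun p : ℝ × E => (2 * τ - p.1, p.2)) (by fun_prop)
    exact h1.sub hVc
  have hgc : Continuous g := by fun_prop
  obtain ⟨⟨t0, θ0⟩, hmem, hmin⟩ := (isCompact_Icc.prod hS).exists_isMinOn (s := Set.Icc p q ×ˢ S)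
    (f := fun p : ℝ × E => W p.1 p.2 / g p.1) ⟨(t1, θ1), ht1, hθ1⟩
    (hWc.continuousOn.div (by fun_prop) (fun x hx => (hgpos _ hx.1).ne'))
  obtain ⟨ht0, hθ0⟩ := hmem
  simp only at ht0 hθ0
  set k := W t0 θ0 / g t0 with hk
  have hmin' : ∀ t ∈ Set.Icc p q, ∀ θ ∈ S, k * g t ≤ W t θ := by
    intro t ht θ hθ
    have := hmin (show (t, θ) ∈ Set.Icc p q ×ˢ S from ⟨ht, hθ⟩)
    simp only [Set.mem_ofPred_eq] at this
    rwa [le_div_iff₀ (hgpos t ht)] at this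
  have hk0 : W t0 θ0 = k * g t0 := by
    rw [hk]; field_simp [(hgpos t0 ht0).ne']
  have hkε : k < -ε := by
    have h1 := hmin' t1 ht1 θ1 hθ1
    have h2 : k * g t1 < -ε * g t1 := lt_of_le_of_lt h1 hcon
    exact lt_of_mul_lt_mul_right h2 (hgpos t1 ht1).le
  have hkg : k * g t0 < -ε * g t0 := mul_lt_mul_of_pos_right hkε (hgpos t0 ht0)
  have hpt : p < t0 := by
    rcases eq_or_lt_of_le ht0.1 with h | h
    · exfalso
      subst h
      have := hp θ0 hθ0
      change -ε * g p ≤ W p θ0 at this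
      linarith
    · exact h
  have htq : t0 < q := by
    rcases eq_or_lt_of_le ht0.2 with h | h
    · exfalso
      subst h
      have := hq θ0 hθ0
      change -ε * g t0 ≤ W t0 θ0 at this
      linarith
    · exact h
  -- time second derivative
  have hT := lv_min_test (f := fun t => W t θ0 - k * g t)
    (f' := fun t => -V1 (2 * τ - t) θ0 - V1 t θ0 - k * (-M * Real.sin (M * (t - tc))))
    (c := V2 (2 * τ - t0) θ0 - V2 t0 θ0 - k * (-M ^ 2 * g t0)) (t := t0)
    (by
      intro s
      have h1 : HasDerivAt (fun t => V (2 * τ - t) θ0) (-V1 (2 * τ - s) θ0) s := by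
        have := (hV1 (2 * τ - s) θ0).scomp s ((hasDerivAt_id s).const_sub (2 * τ))
        simpa [Function.comp_def] using this
      have h2 : HasDerivAt g (-M * Real.sin (M * (s - tc))) s := by
        have h3 : HasDerivAt (fun t => M * (t - tc)) M s := by
          simpa using ((hasDerivAt_id s).sub_const tc).const_mul M
        convert h3.cos using 1
        ring
      exact (h1.sub (hV1 s θ0)).sub (h2.const_mul k))
    (by
      have h1 : HasDerivAt (fun t => -V1 (2 * τ - t) θ0) (V2 (2 * τ - t0) θ0) t0 := by
        have := ((hV2 (2 * τ - t0) θ0).scomp t0 ((hasDerivAt_id t0).const_sub (2 * τ))).neg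
        simpa [Function.comp_def, Pi.neg_def] using this
      have h2 : HasDerivAt (fun s => -M * Real.sin (M * (s - tc))) (-M ^ 2 * g t0) t0 := by
        have h3 : HasDerivAt (fun t => M * (t - tc)) M t0 := by
          simpa using ((hasDerivAt_id t0).sub_const tc).const_mul M
        refine (h3.sin.const_mul (-M)).congr_deriv ?_
        change -M * (Real.cos (M * (t0 - tc)) * M) = -M ^ 2 * Real.cos (M * (t0 - tc))
        ring
      exact (h1.sub (hV2 t0 θ0)).sub (h2.const_mul k))
    (by
      filter_upwards [Icc_mem_nhds hpt htq] with t ht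
      have := hmin' t ht θ0 hθ0
      linarith)
  have hT2 := hT.2
  have hs := hstar 1 1 t0 (2 * τ - t0) θ0 hθ0 (by
    intro θ' hθ'
    have := hmin' t0 ht0 θ' hθ'
    rw [← hk0] at this
    simpa [hW] using this)
  have hw0 : W t0 θ0 < 0 := by
    rw [hk0]
    have : 0 ≤ ε * g t0 := mul_nonneg hε (hgpos t0 ht0).le
    linarith
  have hVp := hpos t0 θ0 hθ0
  have hVp' := hpos (2 * τ - t0) θ0 hθ0
  have hcv := lv_convex hα hVp' hVp
  have hexp : Real.exp (δ * t0) ≤ Real.exp (δ * (2 * τ - t0)) := by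
    apply Real.exp_le_exp.2
    apply mul_le_mul_of_nonneg_left _ hδ.le
    linarith
  have hA : Real.exp (δ * t0) * V (2 * τ - t0) θ0 ^ α
      ≤ Real.exp (δ * (2 * τ - t0)) * V (2 * τ - t0) θ0 ^ α :=
    mul_le_mul_of_nonneg_right hexp (by positivity)
  have hB := mul_le_mul_of_nonneg_left hcv (Real.exp_pos (δ * t0)).le
  have hCC := hC t0 ht0 θ0 hθ0
  have hW0 : W t0 θ0 = V (2 * τ - t0) θ0 - V t0 θ0 := rfl
  have hfin := mul_lt_mul_of_neg_right hCC hw0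
  rw [hW0] at hfin hk0
  have hk1 : k * (-M ^ 2 * g t0) = -M ^ 2 * (V (2 * τ - t0) θ0 - V t0 θ0) := by
    rw [hk0]; ring
  rw [hk1] at hT2
  nlinarith

lemma lv_strict (hδ : 0 < δ)
    (hV1 : ∀ t θ, HasDerivAt (fun s => V s θ) (V1 t θ) t)
    (hV2 : ∀ t θ, HasDerivAt (fun s => V1 s θ) (V2 t θ) t)
    (hpos : ∀ t, ∀ θ ∈ S, 0 < V t θ)
    (hstar : ∀ A B t t' : ℝ, ∀ θ ∈ S,
      (∀ θ' ∈ S, A * V t' θ - B * V t θ ≤ A * V t' θ' - B * V t θ') →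
      A * (V2 t' θ - κ ^ 2 * V t' θ + Real.exp (δ * t') * V t' θ ^ α)
        - B * (V2 t θ - κ ^ 2 * V t θ + Real.exp (δ * t) * V t θ ^ α) ≤ 0)
    (τ : ℝ) (hgood : ∀ t ≤ τ, ∀ θ ∈ S, V t θ ≤ V (2 * τ - t) θ) :
    ∀ t < τ, ∀ θ ∈ S, V t θ < V (2 * τ - t) θ := by
  intro t0 ht0 θ0 hθ0
  rcases eq_or_lt_of_le (hgood t0 ht0.le θ0 hθ0) with h | h
  swap
  · exact h
  exfalso
  have hT := lv_min_test (f := fun t => V (2 * τ - t) θ0 - V t θ0)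
    (f' := fun t => -V1 (2 * τ - t) θ0 - V1 t θ0)
    (c := V2 (2 * τ - t0) θ0 - V2 t0 θ0) (t := t0)
    (by
      intro s
      have h1 : HasDerivAt (fun t => V (2 * τ - t) θ0) (-V1 (2 * τ - s) θ0) s := by
        have := (hV1 (2 * τ - s) θ0).scomp s ((hasDerivAt_id s).const_sub (2 * τ))
        simpa [Function.comp_def] using this
      exact (h1.sub (hV1 s θ0)))
    (by
      have h1 : HasDerivAt (fun t => -V1 (2 * τ - t) θ0) (V2 (2 * τ - t0) θ0) t0 := by
        have := ((hV2 (2 * τ - t0) θ0).scomp t0 ((hasDerivAt_id t0).const_sub (2 * τ))).neg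
        simpa [Function.comp_def, Pi.neg_def] using this
      exact (h1.sub (hV2 t0 θ0)))
    (by
      filter_upwards [Iic_mem_nhds ht0] with t ht
      have := hgood t ht θ0 hθ0
      linarith)
  have hs := hstar 1 1 t0 (2 * τ - t0) θ0 hθ0 (by
    intro θ' hθ'
    have := hgood t0 ht0.le θ' hθ'
    linarith)
  have hexp : Real.exp (δ * t0) < Real.exp (δ * (2 * τ - t0)) := by
    apply Real.exp_lt_exp.2
    apply mul_lt_mul_of_pos_left _ hδ
    linarith
  have hVp := hpos t0 θ0 hθ0
  rw [← h] at hs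
  have := mul_lt_mul_of_pos_right hexp (Real.rpow_pos_of_pos hVp α)
  linarith [hT.2]

lemma lv_mono (hS : IsCompact S) (hα : 1 < α) (hδ : 0 < δ) (hκ : 0 < κ)
    (hVc : Continuous (fun p : ℝ × E => V p.1 p.2))
    (hV1 : ∀ t θ, HasDerivAt (fun s => V s θ) (V1 t θ) t)
    (hV2 : ∀ t θ, HasDerivAt (fun s => V1 s θ) (V2 t θ) t)
    (hpos : ∀ t, ∀ θ ∈ S, 0 < V t θ)
    (hdecay : ∀ ε > 0, ∃ T : ℝ, ∀ t ≤ T, ∀ θ ∈ S, V t θ ≤ ε)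
    (hdecay2 : ∀ ε > 0, ∃ T : ℝ, ∀ t ≤ T, ∀ θ ∈ S,
      α * Real.exp (δ * t) * V t θ ^ (α - 1) < ε)
    (hstar : ∀ A B t t' : ℝ, ∀ θ ∈ S,
      (∀ θ' ∈ S, A * V t' θ - B * V t θ ≤ A * V t' θ' - B * V t θ') →
      A * (V2 t' θ - κ ^ 2 * V t' θ + Real.exp (δ * t') * V t' θ ^ α)
        - B * (V2 t θ - κ ^ 2 * V t θ + Real.exp (δ * t) * V t θ ^ α) ≤ 0)
    (τ : ℝ) : ∀ t ≤ τ, ∀ θ ∈ S, V t θ ≤ V (2 * τ - t) θ := by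
  obtain ⟨T0, hT0⟩ := hdecay2 (κ ^ 2) (by positivity)
  -- far region
  have far : ∀ τ q : ℝ, q ≤ τ → q ≤ T0 → (∀ θ ∈ S, V q θ ≤ V (2 * τ - q) θ) →
      ∀ t ≤ q, ∀ θ ∈ S, V t θ ≤ V (2 * τ - t) θ := by
    intro τ q hqτ hqT hq t ht θ hθ
    apply le_of_forall_pos_le_add
    intro ε hε
    obtain ⟨T1, hT1⟩ := hdecay ε hε
    have := lv_comp (κ := κ) hS hα hδ hVc hV1 hV2 hpos hstar (min T1 t) q τ 0 0 ε hqτ hε.le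
      (by intro t ht; simp)
      (by
        intro t ht θ hθ
        have := hT0 t (ht.2.trans hqT) θ hθ
        simpa using this)
      (by
        intro θ hθ
        have h1 := hT1 (min T1 t) (min_le_left _ _) θ hθ
        have h2 := hpos (2 * τ - min T1 t) θ hθ
        simp
        linarith)
      (by
        intro θ hθ
        have := hq θ hθ
        simp
        linarith) t ⟨min_le_right _ _, ht⟩ θ hθ
    simp at this
    linarith
  have start : ∀ τ ≤ T0, ∀ t ≤ τ, ∀ θ ∈ S, V t θ ≤ V (2 * τ - t) θ := by
    intro τ hτ
    apply far τ τ le_rfl hτ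
    intro θ _
    apply le_of_eq
    congr 1
    ring
  by_contra hbad
  set Bad : Set ℝ := {τ | ¬ ∀ t ≤ τ, ∀ θ ∈ S, V t θ ≤ V (2 * τ - t) θ} with hBad
  have hne : Bad.Nonempty := ⟨τ, hbad⟩
  have hbdd : BddBelow Bad := ⟨T0, fun x hx => by
    by_contra h
    push Not at h
    exact hx (start x h.le)⟩
  set σ := sInf Bad with hσ
  have hT0σ : T0 ≤ σ := le_csInf hne (fun x hx => by
    by_contra h
    push Not at h
    exact hx (start x h.le))
  have hgoodlt : ∀ τ < σ, ∀ t ≤ τ, ∀ θ ∈ S, V t θ ≤ V (2 * τ - t) θ := by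
    intro τ hτ
    by_contra h
    exact absurd (csInf_le hbdd (show τ ∈ Bad from h)) (not_le.2 hτ)
  have hgood : ∀ t ≤ σ, ∀ θ ∈ S, V t θ ≤ V (2 * σ - t) θ := by
    intro t ht θ hθ
    rcases eq_or_lt_of_le ht with h | h
    · subst h
      apply le_of_eq; congr 1; ring
    · have hc : Continuous (fun τ => V (2 * τ - t) θ) :=
        hVc.comp (f := fun τ : ℝ => (2 * τ - t, θ)) (by fun_prop)
      have hlim : Filter.Tendsto (fun τ => V (2 * τ - t) θ) (nhdsWithin σ (Set.Iio σ))
          (nhds (V (2 * σ - t) θ)) := (hc.tendsto σ).mono_left nhdsWithin_le_nhds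
      apply ge_of_tendsto hlim
      filter_upwards [Ioo_mem_nhdsLT h] with τ hτ
      exact hgoodlt τ hτ.2 t hτ.1.le θ hθ
  have hstrict := lv_strict (κ := κ) (α := α) hδ hV1 hV2 hpos hstar σ hgood
  -- bound C on the compact
  obtain ⟨C, hC⟩ : ∃ C : ℝ, ∀ t ∈ Set.Icc (T0 - 1) (σ + 1), ∀ θ ∈ S,
      α * Real.exp (δ * t) * V t θ ^ (α - 1) ≤ C := by
    have hcont : Continuous (fun p : ℝ × E => α * Real.exp (δ * p.1) * V p.1 p.2 ^ (α - 1)) := by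
      apply Continuous.mul (by fun_prop)
      exact hVc.rpow_const (fun _ => Or.inr (by linarith))
    obtain ⟨C, hC⟩ := (isCompact_Icc.prod hS).bddAbove_image (f := fun p : ℝ × E =>
      α * Real.exp (δ * p.1) * V p.1 p.2 ^ (α - 1)) (K := Set.Icc (T0 - 1) (σ + 1) ×ˢ S)
      hcont.continuousOn
    exact ⟨C, fun t ht θ hθ => hC ⟨(t, θ), ⟨ht, hθ⟩, rfl⟩⟩
  set M := |C| + 1 with hM
  have hM1 : 1 ≤ M := by have := abs_nonneg C; linarith
  have hMC : C < M ^ 2 + κ ^ 2 := by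
    have : C ≤ |C| := le_abs_self C
    nlinarith [sq_nonneg κ]
  set η := 1 / M with hη
  have hη0 : 0 < η := by positivity
  have hη1 : η ≤ 1 := by rw [hη, div_le_one (by linarith)]; exact hM1
  have hMη : M * η = 1 := by rw [hη]; field_simp
  -- the middle compact
  have hmid : ∀ᶠ τ in nhds σ, ∀ x ∈ Set.Icc (T0 - 1) (σ - η) ×ˢ S, V x.1 x.2 < V (2 * τ - x.1) x.2 := by
    have hK : IsCompact (Set.Icc (T0 - 1) (σ - η) ×ˢ S) := isCompact_Icc.prod hS
    apply hK.eventually_forall_of_forall_eventually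
    rintro ⟨t, θ⟩ ⟨ht, hθ⟩
    have hc1 : Continuous (fun z : ℝ × (ℝ × E) => V (2 * z.1 - z.2.1) z.2.2) :=
      hVc.comp (f := fun z : ℝ × (ℝ × E) => (2 * z.1 - z.2.1, z.2.2)) (by fun_prop)
    have hc2 : Continuous (fun z : ℝ × (ℝ × E) => V z.2.1 z.2.2) :=
      hVc.comp (f := fun z : ℝ × (ℝ × E) => (z.2.1, z.2.2)) (by fun_prop)
    have := (isOpen_lt hc2 hc1).mem_nhds (x := (σ, (t, θ))) (by
      have := ht.2
      simp only at this
      exact hstrict t (by linarith) θ hθ)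
    exact this
  obtain ⟨r, hr, hball⟩ := Metric.eventually_nhds_iff.1 hmid
  obtain ⟨τ, hτB, hτlt⟩ := exists_lt_of_csInf_lt hne (show sInf Bad < σ + min (r / 2) (η / 2) by
    have : 0 < min (r / 2) (η / 2) := by positivity
    linarith)
  have hστ : σ ≤ τ := csInf_le hbdd hτB
  have hm1 := min_le_left (r / 2) (η / 2)
  have hm2 := min_le_right (r / 2) (η / 2)
  have hmid' := hball (y := τ) (by
    rw [Real.dist_eq, abs_of_nonneg (by linarith)]
    linarith)
  apply hτB
  by_cases hcase : T0 - 1 ≤ σ - η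
  swap
  · push Not at hcase
    linarith
  have hmidθ : ∀ t, T0 - 1 ≤ t → t ≤ σ - η → ∀ θ ∈ S, V t θ ≤ V (2 * τ - t) θ :=
    fun t h1 h2 θ hθ => (hmid' (t, θ) ⟨⟨h1, h2⟩, hθ⟩).le
  have hnar := lv_comp (κ := κ) hS hα hδ hVc hV1 hV2 hpos hstar (σ - η) τ τ M σ 0 le_rfl le_rfl
      (by
        intro t ht
        rw [abs_mul, abs_of_nonneg (by linarith : (0:ℝ) ≤ M), ← hMη]
        apply mul_le_mul_of_nonneg_left _ (by linarith)
        rw [abs_le]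
        constructor <;> linarith [ht.1, ht.2])
      (by
        intro t ht θ hθ
        exact lt_of_le_of_lt (hC t ⟨by linarith [ht.1], by linarith [ht.2]⟩ θ hθ) hMC)
      (by
        intro θ hθ
        have := hmidθ (σ - η) hcase le_rfl θ hθ
        simp only [neg_zero, zero_mul]
        linarith)
      (by
        intro θ hθ
        have : 2 * τ - τ = τ := by ring
        rw [this]
        simp)
  intro t ht θ hθ
  rcases le_total t (T0 - 1) with h1 | h1
  · exact far τ (T0 - 1) (by linarith) (by linarith) (hmidθ _ le_rfl hcase) t h1 θ hθ
  rcases le_total t (σ - η) with h2 | h2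
  · exact hmidθ t h1 h2 θ hθ
  · have := hnar t ⟨h2, ht⟩ θ hθ
    simp only [neg_zero, zero_mul] at this
    linarith

lemma lv_cyl (hS : IsCompact S) (hSne : S.Nonempty) (hα : 1 < α) (hδ : 0 < δ) (hκ : 0 < κ)
    (hVc : Continuous (fun p : ℝ × E => V p.1 p.2))
    (hV1 : ∀ t θ, HasDerivAt (fun s => V s θ) (V1 t θ) t)
    (hV2 : ∀ t θ, HasDerivAt (fun s => V1 s θ) (V2 t θ) t)
    (hpos : ∀ t, ∀ θ ∈ S, 0 < V t θ)
    (hdecay : ∀ ε > 0, ∃ T : ℝ, ∀ t ≤ T, ∀ θ ∈ S, V t θ ≤ ε)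
    (hdecay2 : ∀ ε > 0, ∃ T : ℝ, ∀ t ≤ T, ∀ θ ∈ S,
      α * Real.exp (δ * t) * V t θ ^ (α - 1) < ε)
    (hstar : ∀ A B t t' : ℝ, ∀ θ ∈ S,
      (∀ θ' ∈ S, A * V t' θ - B * V t θ ≤ A * V t' θ' - B * V t θ') →
      A * (V2 t' θ - κ ^ 2 * V t' θ + Real.exp (δ * t') * V t' θ ^ α)
        - B * (V2 t θ - κ ^ 2 * V t θ + Real.exp (δ * t) * V t θ ^ α) ≤ 0) : False := by
  have hmono := lv_mono hS hα hδ hκ hVc hV1 hV2 hpos hdecay hdecay2 hstar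
  have hV0c : Continuous (fun θ => V 0 θ) := hVc.comp (f := fun θ : E => ((0:ℝ), θ)) (by fun_prop)
  obtain ⟨θm, hθm, hmin⟩ := hS.exists_isMinOn hSne hV0c.continuousOn
  set c := V 0 θm with hc
  have hc0 : 0 < c := hpos 0 θm hθm
  have hlow : ∀ t ≥ 0, ∀ θ ∈ S, c ≤ V t θ := by
    intro t ht θ hθ
    have h1 := hmono (t / 2) 0 (by linarith) θ hθ
    have h2 : 2 * (t / 2) - 0 = t := by ring
    rw [h2] at h1
    exact le_trans (hmin hθ) h1
  have hc1 : 0 < c ^ (α - 1) := by positivity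
  obtain ⟨T, hT0, hT⟩ : ∃ T : ℝ, 0 ≤ T ∧ ∀ t ≥ T, 1 + κ ^ 2 < Real.exp (δ * t) * c ^ (α - 1) := by
    refine ⟨(1 + κ ^ 2) / c ^ (α - 1) / δ, by positivity, fun t ht => ?_⟩
    rw [ge_iff_le, div_le_iff₀ hδ, div_le_iff₀ hc1] at ht
    have h1 : δ * t < Real.exp (δ * t) := by linarith [Real.add_one_le_exp (δ * t)]
    have := mul_lt_mul_of_pos_right h1 hc1
    linarith
  have hpi := Real.pi_pos
  set φ : ℝ → ℝ := fun t => Real.sin (t - T) with hφ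
  obtain ⟨⟨t0, θ0⟩, hmem, hmax⟩ := (isCompact_Icc.prod hS).exists_isMaxOn
    (s := Set.Icc T (T + Real.pi) ×ˢ S)
    (f := fun p : ℝ × E => φ p.1 / V p.1 p.2)
    ⟨(T, θm), ⟨le_rfl, by linarith⟩, hθm⟩
    (ContinuousOn.div (by fun_prop) hVc.continuousOn (fun x hx => (hpos _ _ hx.2).ne'))
  obtain ⟨ht0, hθ0⟩ := hmem
  simp only at ht0 hθ0
  set k := φ t0 / V t0 θ0 with hk
  have hV0 := hpos t0 θ0 hθ0
  have hmax' : ∀ t ∈ Set.Icc T (T + Real.pi), ∀ θ ∈ S, φ t ≤ k * V t θ := by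
    intro t ht θ hθ
    have := hmax (show (t, θ) ∈ Set.Icc T (T + Real.pi) ×ˢ S from ⟨ht, hθ⟩)
    simp only [Set.mem_ofPred_eq] at this
    rwa [div_le_iff₀ (hpos t θ hθ)] at this
  have hk0 : φ t0 = k * V t0 θ0 := by rw [hk]; field_simp
  have hkpos : 0 < k := by
    have h := hmax' (T + Real.pi / 2) ⟨by linarith, by linarith⟩ θm hθm
    have h1 : φ (T + Real.pi / 2) = 1 := by simp [hφ]
    rw [h1] at h
    have := hpos (T + Real.pi / 2) θm hθm
    by_contra hk'
    push Not at hk'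
    nlinarith
  have hφpos : 0 < φ t0 := by rw [hk0]; positivity
  have ht1 : T < t0 := by
    rcases eq_or_lt_of_le ht0.1 with h | h
    · exfalso
      rw [← h] at hφpos
      simp [hφ] at hφpos
    · exact h
  have ht2 : t0 < T + Real.pi := by
    rcases eq_or_lt_of_le ht0.2 with h | h
    · exfalso
      rw [h] at hφpos
      simp [hφ] at hφpos
    · exact h
  have hTT := lv_min_test (f := fun t => k * V t θ0 - φ t)
    (f' := fun t => k * V1 t θ0 - Real.cos (t - T))
    (c := k * V2 t0 θ0 - (-φ t0)) (t := t0)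
    (by
      intro s
      have h2 : HasDerivAt φ (Real.cos (s - T)) s := by
        simpa using ((hasDerivAt_id s).sub_const T).sin
      exact ((hV1 s θ0).const_mul k).sub h2)
    (by
      have h2 : HasDerivAt (fun t => Real.cos (t - T)) (-φ t0) t0 := by
        simpa using ((hasDerivAt_id t0).sub_const T).cos
      exact ((hV2 t0 θ0).const_mul k).sub h2)
    (by
      filter_upwards [Icc_mem_nhds ht1 ht2] with t ht
      have := hmax' t ht θ0 hθ0
      linarith)
  have hs := hstar 1 0 t0 t0 θ0 hθ0 (by
    intro θ' hθ'
    have := hmax' t0 ht0 θ' hθ'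
    rw [hk0] at this
    have := le_of_mul_le_mul_left this hkpos
    linarith)
  have h1 : 0 ≤ k * (V2 t0 θ0 + V t0 θ0) := by linarith [hTT.2]
  have h2 : 0 ≤ V2 t0 θ0 + V t0 θ0 := by
    by_contra h
    push Not at h
    nlinarith
  have h3 : V t0 θ0 ^ α = V t0 θ0 ^ (α - 1) * V t0 θ0 := by
    rw [← Real.rpow_add_one hV0.ne']; congr 1; ring
  rw [h3] at hs
  have h4 : c ^ (α - 1) ≤ V t0 θ0 ^ (α - 1) :=
    Real.rpow_le_rpow hc0.le (hlow t0 (by linarith) θ0 hθ0) (by linarith)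
  have h5 := hT t0 ht1.le
  have h6 := mul_le_mul_of_nonneg_left h4 (Real.exp_pos (δ * t0)).le
  have h7 := mul_lt_mul_of_pos_right (lt_of_lt_of_le h5 h6) hV0
  nlinarith
end cyl

section geo
variable {ι : Type*} [Fintype ι] [DecidableEq ι] {U : (ι → ℝ) → ℝ}

lemma lv_curve (hU : ContDiff ℝ 2 U) {γ γ1 : ℝ → (ι → ℝ)} {γ2 : ι → ℝ} {t : ℝ}
    (h1 : ∀ s, HasDerivAt γ (γ1 s) s) (h2 : HasDerivAt γ1 γ2 t) :
    (∀ s, HasDerivAt (fun s => U (γ s)) (fderiv ℝ U (γ s) (γ1 s)) s) ∧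
    HasDerivAt (fun s => fderiv ℝ U (γ s) (γ1 s))
      (fderiv ℝ (fderiv ℝ U) (γ t) (γ1 t) (γ1 t) + fderiv ℝ U (γ t) γ2) t := by
  have hd : Differentiable ℝ U := hU.differentiable (by norm_num)
  have hd2 : Differentiable ℝ (fderiv ℝ U) :=
    (hU.fderiv_right (m := 1) (by norm_num)).differentiable (by norm_num)
  constructor
  · intro s
    exact (hd (γ s)).hasFDerivAt.comp_hasDerivAt s (h1 s)
  · have h3 : HasDerivAt (fun s => fderiv ℝ U (γ s)) (fderiv ℝ (fderiv ℝ U) (γ t) (γ1 t)) t :=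
      (hd2 (γ t)).hasFDerivAt.comp_hasDerivAt t (h1 t)
    exact h3.clm_apply h2

lemma lv_sphere (hU : ContDiff ℝ 2 U) {A B ρ₁ ρ₂ : ℝ} {θ ξ : ι → ℝ}
    (hθ : θ ⬝ᵥ θ = 1) (hξ : ξ ⬝ᵥ θ = 0)
    (hmin : ∀ θ' : ι → ℝ, θ' ⬝ᵥ θ' = 1 →
      A * U (ρ₁ • θ) - B * U (ρ₂ • θ) ≤ A * U (ρ₁ • θ') - B * U (ρ₂ • θ')) :
    A * (ρ₁ * fderiv ℝ U (ρ₁ • θ) ξ) - B * (ρ₂ * fderiv ℝ U (ρ₂ • θ) ξ) = 0 ∧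
    0 ≤ A * (ρ₁ ^ 2 * fderiv ℝ (fderiv ℝ U) (ρ₁ • θ) ξ ξ)
      - B * (ρ₂ ^ 2 * fderiv ℝ (fderiv ℝ U) (ρ₂ • θ) ξ ξ)
      - (ξ ⬝ᵥ ξ) * (A * (ρ₁ * fderiv ℝ U (ρ₁ • θ) θ) - B * (ρ₂ * fderiv ℝ U (ρ₂ • θ) θ)) := by
  by_cases h0 : ξ = 0
  · subst h0; simp
  have hξ2 : 0 < ξ ⬝ᵥ ξ := by
    have h1 : ξ ⬝ᵥ ξ = ∑ i, ξ i ^ 2 := by simp [dotProduct, pow_two]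
    rw [h1]
    obtain ⟨i, hi⟩ := Function.ne_iff.1 h0
    exact Finset.sum_pos' (fun i _ => sq_nonneg _) ⟨i, Finset.mem_univ _, by
      have : ξ i ≠ 0 := hi
      positivity⟩
  set c := Real.sqrt (ξ ⬝ᵥ ξ) with hc
  have hc0 : 0 < c := Real.sqrt_pos.2 hξ2
  have hc2 : c ^ 2 = ξ ⬝ᵥ ξ := Real.sq_sqrt hξ2.le
  set γ : ℝ → (ι → ℝ) := fun s => Real.cos (c * s) • θ + (Real.sin (c * s) / c) • ξ with hγ
  set γ1 : ℝ → (ι → ℝ) := fun s => (-c * Real.sin (c * s)) • θ + (Real.cos (c * s)) • ξ with hγ1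
  have hcs : ∀ s, HasDerivAt (fun s => c * s) c s := fun s => by
    simpa using (hasDerivAt_id s).const_mul c
  have d1 : ∀ s, HasDerivAt γ (γ1 s) s := by
    intro s
    have e1 : HasDerivAt (fun s => Real.cos (c * s)) (-c * Real.sin (c * s)) s :=
      ((hcs s).cos).congr_deriv (by ring)
    have e2 : HasDerivAt (fun s => Real.sin (c * s) / c) (Real.cos (c * s)) s :=
      ((hcs s).sin.div_const c).congr_deriv (by field_simp)
    exact (e1.smul_const θ).add (e2.smul_const ξ)
  have d2 : HasDerivAt γ1 (-c ^ 2 • θ) 0 := by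
    have e1 : HasDerivAt (fun s => -c * Real.sin (c * s)) (-c ^ 2) 0 :=
      ((hcs 0).sin.const_mul (-c)).congr_deriv (by simp; ring)
    have e2 : HasDerivAt (fun s => Real.cos (c * s)) 0 0 :=
      ((hcs 0).cos).congr_deriv (by simp)
    exact ((e1.smul_const θ).add (e2.smul_const ξ)).congr_deriv (by simp)
  have γ0 : γ 0 = θ := by simp [hγ]
  have γ10 : γ1 0 = ξ := by simp [hγ1]
  have hsph : ∀ s, γ s ⬝ᵥ γ s = 1 := by
    intro s
    have hξ' : θ ⬝ᵥ ξ = 0 := by rw [dotProduct_comm]; exact hξ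
    simp only [hγ, add_dotProduct, dotProduct_add, smul_dotProduct, dotProduct_smul, hθ, hξ, hξ',
      ← hc2, smul_eq_mul]
    have := Real.sin_sq_add_cos_sq (c * s)
    have h2 : Real.sin (c * s) / c * (Real.sin (c * s) / c * c ^ 2) = Real.sin (c * s) ^ 2 := by
      field_simp
    linear_combination h2 + this
  have key : ∀ ρ : ℝ, (∀ s, HasDerivAt (fun s => U (ρ • γ s))
      (ρ * fderiv ℝ U (ρ • γ s) (γ1 s)) s) ∧
      HasDerivAt (fun s => ρ * fderiv ℝ U (ρ • γ s) (γ1 s))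
        (ρ ^ 2 * fderiv ℝ (fderiv ℝ U) (ρ • θ) ξ ξ - c ^ 2 * (ρ * fderiv ℝ U (ρ • θ) θ)) 0 := by
    intro ρ
    have := lv_curve hU (γ := fun s => ρ • γ s) (γ1 := fun s => ρ • γ1 s)
      (γ2 := ρ • (-c ^ 2 • θ)) (t := 0) (fun s => (d1 s).const_smul ρ) (d2.const_smul ρ)
    simp only [map_smul, smul_eq_mul, smul_apply, γ0, γ10, map_neg, neg_smul] at this
    refine ⟨this.1, this.2.congr_deriv ?_⟩
    ring
  have := lv_min_test (f := fun s => A * U (ρ₁ • γ s) - B * U (ρ₂ • γ s))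
    (fun s => (((key ρ₁).1 s).const_mul A).sub (((key ρ₂).1 s).const_mul B))
    (((key ρ₁).2).const_mul A |>.sub (((key ρ₂).2).const_mul B))
    (by
      filter_upwards with s
      rw [γ0]
      exact hmin (γ s) (hsph s))
  simp only [γ0, γ10] at this
  refine ⟨this.1, ?_⟩
  rw [← hc2]
  linarith [this.2]

lemma lv_star (hU : ContDiff ℝ 2 U) {b : ι → ℝ} (hb : ∀ i, 0 ≤ b i) {α : ℝ}
    {G : ι → (ι → ℝ) → ℝ}
    (hG1 : ∀ i, b i ≠ 0 → ∀ z, fderiv ℝ U z (Pi.single i 1) = z i * G i z)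
    (hG2 : ∀ i, b i ≠ 0 → ∀ z : ι → ℝ, z i = 0 →
      fderiv ℝ (fderiv ℝ U) z (Pi.single i 1) (Pi.single i 1) = G i z)
    (heq : ∀ z, (∑ i, (fderiv ℝ (fderiv ℝ U) z (Pi.single i 1) (Pi.single i 1)
      + b i * G i z)) + U z ^ α = 0)
    {A B ρ₁ ρ₂ : ℝ} (hρ₁ : 0 < ρ₁) (hρ₂ : 0 < ρ₂) {θ : ι → ℝ}
    (hθ : θ ⬝ᵥ θ = 1)
    (hmin : ∀ θ' : ι → ℝ, θ' ⬝ᵥ θ' = 1 →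
      A * U (ρ₁ • θ) - B * U (ρ₂ • θ) ≤ A * U (ρ₁ • θ') - B * U (ρ₂ • θ')) :
    A * (ρ₁ ^ 2 * fderiv ℝ (fderiv ℝ U) (ρ₁ • θ) θ θ
      + (Fintype.card ι + ∑ i, b i - 1) * (ρ₁ * fderiv ℝ U (ρ₁ • θ) θ) + ρ₁ ^ 2 * U (ρ₁ • θ) ^ α)
    - B * (ρ₂ ^ 2 * fderiv ℝ (fderiv ℝ U) (ρ₂ • θ) θ θ
      + (Fintype.card ι + ∑ i, b i - 1) * (ρ₂ * fderiv ℝ U (ρ₂ • θ) θ) + ρ₂ ^ 2 * U (ρ₂ • θ) ^ α)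
      ≤ 0 := by
  set g : ℝ → (ι → ℝ) →L[ℝ] ℝ := fun ρ => fderiv ℝ U (ρ • θ) with hg
  set H : ℝ → (ι → ℝ) →L[ℝ] (ι → ℝ) →L[ℝ] ℝ := fun ρ => fderiv ℝ (fderiv ℝ U) (ρ • θ) with hH
  set e : ι → (ι → ℝ) := fun i => Pi.single i 1 with he
  set ξ : ι → (ι → ℝ) := fun i => e i - θ i • θ with hξ
  have hξθ : ∀ i, ξ i ⬝ᵥ θ = 0 := by
    intro i
    simp [hξ, he, sub_dotProduct, smul_dotProduct, hθ]
  have hξξ : ∀ i, ξ i ⬝ᵥ ξ i = 1 - θ i ^ 2 := by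
    intro i
    have : ξ i ⬝ᵥ ξ i = ξ i ⬝ᵥ e i - θ i * (ξ i ⬝ᵥ θ) := by
      conv_lhs => rw [show ξ i ⬝ᵥ ξ i = ξ i ⬝ᵥ (e i - θ i • θ) from rfl]
      rw [dotProduct_sub, dotProduct_smul, smul_eq_mul]
    rw [this, hξθ]
    simp [hξ, he]
    ring
  have hS := fun i => lv_sphere hU hθ (hξθ i) hmin
  set D := A * (ρ₁ * g ρ₁ θ) - B * (ρ₂ * g ρ₂ θ) with hD
  have hθ2 : ∑ i, θ i ^ 2 = 1 := by rw [← hθ]; simp [dotProduct, pow_two]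
  have hsumθ : ∑ i, θ i • e i = θ := by
    ext j; simp [he, Finset.sum_apply, Pi.single_apply]
  -- trace identity
  have htr : ∀ ρ, ∑ i, H ρ (ξ i) (ξ i) = ∑ i, H ρ (e i) (e i) - H ρ θ θ := by
    intro ρ
    have h1 : ∀ i, H ρ (ξ i) (ξ i) = H ρ (e i) (e i) - H ρ (θ i • e i) θ - H ρ θ (θ i • e i)
        + θ i ^ 2 * H ρ θ θ := by
      intro i
      simp only [hξ, map_sub, map_smul, sub_apply,
        smul_apply, smul_eq_mul]
      ring
    simp only [h1, Finset.sum_add_distrib, Finset.sum_sub_distrib, ← Finset.sum_mul, hθ2]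
    have h2 : ∑ i, H ρ (θ i • e i) θ = H ρ θ θ := by
      have h4 : H ρ θ = ∑ i, H ρ (θ i • e i) := by rw [← map_sum, hsumθ]
      rw [h4, sum_apply]
    have h3 : ∑ i, H ρ θ (θ i • e i) = H ρ θ θ := by
      rw [← map_sum, hsumθ]
    rw [h2, h3]
    ring
  have hsum := Finset.sum_nonneg (s := Finset.univ) (fun i _ => (hS i).2)
  change 0 ≤ ∑ i, (A * (ρ₁ ^ 2 * H ρ₁ (ξ i) (ξ i)) - B * (ρ₂ ^ 2 * H ρ₂ (ξ i) (ξ i))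
    - (ξ i ⬝ᵥ ξ i) * D) at hsum
  simp only [hξξ, Finset.sum_sub_distrib, ← Finset.mul_sum, ← Finset.sum_mul, htr, hθ2] at hsum
  simp only [Finset.sum_const, Finset.card_univ, nsmul_eq_mul, mul_one] at hsum
  -- drift part
  have hdr : ∀ i, 0 ≤ b i * (A * (ρ₁ ^ 2 * G i (ρ₁ • θ)) - B * (ρ₂ ^ 2 * G i (ρ₂ • θ)) - D) := by
    intro i
    by_cases hbi : b i = 0
    · simp [hbi]
    by_cases hti : θ i = 0
    · apply mul_nonneg (hb i)
      have h1 := (hS i).2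
      have h2 : ξ i = e i := by simp [hξ, hti]
      rw [hξξ, h2, hti] at h1
      rw [hG2 i hbi (ρ₁ • θ) (by simp [hti]), hG2 i hbi (ρ₂ • θ) (by simp [hti])] at h1
      simp only [hD, hg]
      linarith
    · apply mul_nonneg (hb i)
      apply le_of_eq
      have h1 := (hS i).1
      change A * (ρ₁ * g ρ₁ (e i - θ i • θ)) - B * (ρ₂ * g ρ₂ (e i - θ i • θ)) = 0 at h1
      have h3 : g ρ₁ (e i) = ρ₁ * θ i * G i (ρ₁ • θ) := by
        simpa using hG1 i hbi (ρ₁ • θ)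
      have h4 : g ρ₂ (e i) = ρ₂ * θ i * G i (ρ₂ • θ) := by
        simpa using hG1 i hbi (ρ₂ • θ)
      rw [map_sub, map_sub, h3, h4, map_smul, map_smul, smul_eq_mul, smul_eq_mul] at h1
      apply mul_left_cancel₀ hti
      rw [hD]
      linear_combination -h1
  have hdrs := Finset.sum_nonneg (s := Finset.univ) (fun i _ => hdr i)
  have e1 := heq (ρ₁ • θ)
  have e2 := heq (ρ₂ • θ)
  rw [Finset.sum_add_distrib] at e1 e2
  change ∑ i, H ρ₁ (e i) (e i) + _ + _ = 0 at e1
  change ∑ i, H ρ₂ (e i) (e i) + _ + _ = 0 at e2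
  have hexp : ∑ i, b i * (A * (ρ₁ ^ 2 * G i (ρ₁ • θ)) - B * (ρ₂ ^ 2 * G i (ρ₂ • θ)) - D)
      = A * ρ₁ ^ 2 * (∑ i, b i * G i (ρ₁ • θ)) - B * ρ₂ ^ 2 * (∑ i, b i * G i (ρ₂ • θ))
        - (∑ i, b i) * D := by
    simp only [Finset.mul_sum, Finset.sum_mul, ← Finset.sum_sub_distrib]
    apply Finset.sum_congr rfl
    intro i _
    ring
  rw [hexp] at hdrs
  set s1 := ∑ i, b i * G i (ρ₁ • θ)
  set s2 := ∑ i, b i * G i (ρ₂ • θ)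
  have e1' : s1 = -U (ρ₁ • θ) ^ α - ∑ i, H ρ₁ (e i) (e i) := by linarith
  have e2' : s2 = -U (ρ₂ • θ) ^ α - ∑ i, H ρ₂ (e i) (e i) := by linarith
  rw [e1', e2'] at hdrs
  change A * (ρ₁ ^ 2 * H ρ₁ θ θ + _ * (ρ₁ * g ρ₁ θ) + _)
    - B * (ρ₂ ^ 2 * H ρ₂ θ θ + _ * (ρ₂ * g ρ₂ θ) + _) ≤ 0
  rw [hD] at hdrs hsum
  linarith

lemma lv_pos (hU : ContDiff ℝ 2 U) {b : ι → ℝ} (hb : ∀ i, 0 ≤ b i) {α : ℝ}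
    {G : ι → (ι → ℝ) → ℝ} (hU0 : ∀ z, 0 ≤ U z)
    (hG1 : ∀ i, b i ≠ 0 → ∀ z, fderiv ℝ U z (Pi.single i 1) = z i * G i z)
    (heq : ∀ z, (∑ i, (fderiv ℝ (fderiv ℝ U) z (Pi.single i 1) (Pi.single i 1)
      + b i * G i z)) + U z ^ α = 0)
    (p : ι → ℝ) (hp : ∀ i, b i ≠ 0 → 0 < p i) (hUp : 0 < U p)
    (z1 : ι → ℝ) (hz1 : ∀ i, b i ≠ 0 → 0 ≤ z1 i) : 0 < U z1 := by
  by_contra hcon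
  have hz10 : U z1 = 0 := le_antisymm (not_lt.1 hcon) (hU0 z1)
  set q : (ι → ℝ) → ℝ := fun z => (z - p) ⬝ᵥ (z - p) with hq
  have hqs : ∀ z, q z = ∑ i, (z i - p i) ^ 2 := by intro z; simp [hq, dotProduct, pow_two]
  have hqi : ∀ z i, (z i - p i) ^ 2 ≤ q z := by
    intro z i
    rw [hqs]
    exact Finset.single_le_sum (f := fun i => (z i - p i) ^ 2) (fun _ _ => sq_nonneg _)
      (Finset.mem_univ i)
  have hqc : Continuous q := by
    have : q = fun z => ∑ i, (z i - p i) ^ 2 := funext hqs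
    rw [this]; fun_prop
  set ε := U p / 2 with hε
  have hε0 : 0 < ε := by positivity
  obtain ⟨r, hr, hrU⟩ : ∃ r > 0, ∀ z, q z ≤ r → ε ≤ U z := by
    have := hU.continuous.continuousAt.eventually (lt_mem_nhds (show ε < U p by linarith))
    obtain ⟨r, hr, h⟩ := Metric.eventually_nhds_iff.1 this
    refine ⟨(r / 2) ^ 2, by positivity, fun z hz => (h ?_).le⟩
    rw [dist_pi_lt_iff hr]
    intro i
    have h1 := (hqi z i).trans hz
    rw [Real.dist_eq]
    have := abs_le_of_sq_le_sq h1 (by positivity)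
    linarith
  have hq1 : r < q z1 := by
    by_contra h
    have := hrU z1 (not_lt.1 h)
    linarith
  set N : ℝ := ∑ i, (1 + b i) with hN
  have hN0 : 0 ≤ N := Finset.sum_nonneg (fun i _ => by linarith [hb i])
  set K := (N + 1) / r with hK
  have hK0 : 0 < K := by positivity
  have hKr : K * r = N + 1 := by rw [hK]; field_simp
  set R := q z1 + 1 with hR
  set F : (ι → ℝ) → ℝ := fun z => U z - ε * (Real.exp (-K * q z) - Real.exp (-K * R)) with hF
  have hFc : Continuous F := by
    have := hU.continuous
    fun_prop
  set D : Set (ι → ℝ) := {z | (∀ i, b i ≠ 0 → 0 ≤ z i) ∧ r ≤ q z ∧ q z ≤ R} with hD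
  have hDc : IsCompact D := by
    apply Metric.isCompact_of_isClosed_isBounded
    · have h1 : IsClosed {z : ι → ℝ | ∀ i, b i ≠ 0 → 0 ≤ z i} := by
        simp only [Set.ofPred_forall]
        exact isClosed_iInter fun i => isClosed_iInter fun _ =>
          isClosed_le continuous_const (continuous_apply i)
      exact h1.inter ((isClosed_le continuous_const hqc).inter (isClosed_le hqc continuous_const))
    · apply (Metric.isBounded_closedBall (x := p) (r := R + 1)).subset
      intro z hz
      rw [Metric.mem_closedBall, dist_pi_le_iff (by linarith)]
      intro i
      rw [Real.dist_eq]
      have h1 := (hqi z i).trans hz.2.2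
      have : (z i - p i) ^ 2 ≤ (R + 1) ^ 2 := by nlinarith
      exact abs_le.2 (abs_le_of_sq_le_sq' this (by linarith))
  obtain ⟨z, hzD, hzmin⟩ := hDc.exists_isMinOn ⟨z1, hz1, hq1.le, by linarith⟩ hFc.continuousOn
  have hFz1 : F z1 < 0 := by
    have : Real.exp (-K * R) < Real.exp (-K * q z1) := by
      apply Real.exp_lt_exp.2
      nlinarith
    simp only [hF, hz10]
    nlinarith
  have hFz : F z < 0 := lt_of_le_of_lt (hzmin (show z1 ∈ D from ⟨hz1, hq1.le, by linarith⟩)) hFz1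
  have hzr : r < q z := by
    rcases eq_or_lt_of_le hzD.2.1 with h | h
    · exfalso
      have h1 := hrU z h.ge
      have h2 : Real.exp (-K * q z) ≤ 1 := Real.exp_le_one_iff.2 (by nlinarith)
      have h3 := Real.exp_pos (-K * R)
      simp only [hF] at hFz
      nlinarith
    · exact h
  have hzR : q z < R := by
    rcases eq_or_lt_of_le hzD.2.2 with h | h
    · exfalso
      simp only [hF, h] at hFz
      have := hU0 z
      linarith
    · exact h
  set X := Real.exp (-K * q z) with hX
  have hX0 : 0 < X := Real.exp_pos _
  -- line derivatives
  have hline : ∀ i s, q (z + s • Pi.single i 1) = q z + 2 * s * (z i - p i) + s ^ 2 := by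
    intro i s
    have : z + s • Pi.single i 1 - p = (z - p) + s • Pi.single i (1:ℝ) := by abel
    simp only [hq, this]
    simp [add_dotProduct, dotProduct_add, smul_dotProduct, dotProduct_smul]
    ring
  have hder : ∀ i, ∃ f' : ℝ → ℝ, (∀ s, HasDerivAt (fun s => F (z + s • Pi.single i 1)) (f' s) s) ∧
      f' 0 = fderiv ℝ U z (Pi.single i 1) + 2 * K * ε * X * (z i - p i) ∧
      HasDerivAt f' (fderiv ℝ (fderiv ℝ U) z (Pi.single i 1) (Pi.single i 1)
        - ε * X * (4 * K ^ 2 * (z i - p i) ^ 2 - 2 * K)) 0 := by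
    intro i
    have hl : ∀ s : ℝ, HasDerivAt (fun s : ℝ => z + s • (Pi.single i 1 : ι → ℝ)) (Pi.single i 1) s := by
      intro s
      have := ((hasDerivAt_id s).smul_const (Pi.single i (1:ℝ) : ι → ℝ)).const_add z
      simpa using this
    obtain ⟨c1, c2⟩ := lv_curve hU (γ := fun s : ℝ => z + s • (Pi.single i 1 : ι → ℝ))
      (γ1 := fun _ => Pi.single i 1) (γ2 := 0) (t := 0) hl (hasDerivAt_const _ _)
    set d := z i - p i with hd
    have hE : ∀ s, HasDerivAt (fun s => Real.exp (-K * (q z + 2 * s * d + s ^ 2)))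
        (Real.exp (-K * (q z + 2 * s * d + s ^ 2)) * (-K * (2 * d + 2 * s))) s := by
      intro s
      apply HasDerivAt.exp
      apply HasDerivAt.const_mul
      have h1 : HasDerivAt (fun s => q z + 2 * s * d) (2 * d) s := by
        have := (((hasDerivAt_id s).const_mul 2).mul_const d).const_add (q z)
        simpa using this
      have h2 : HasDerivAt (fun s : ℝ => s ^ 2) (2 * s) s := by
        simpa using hasDerivAt_pow 2 s
      exact h1.add h2
    have hE2 : HasDerivAt (fun s => Real.exp (-K * (q z + 2 * s * d + s ^ 2)) * (-K * (2 * d + 2 * s)))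
        (X * (4 * K ^ 2 * d ^ 2 - 2 * K)) 0 := by
      have h1 : HasDerivAt (fun s : ℝ => -K * (2 * d + 2 * s)) (-K * 2) 0 := by
        have := (((hasDerivAt_id (0:ℝ)).const_mul 2).const_add (2 * d)).const_mul (-K)
        simpa using this
      refine ((hE 0).mul h1).congr_deriv ?_
      simp only [hX]
      ring_nf
    refine ⟨fun s => fderiv ℝ U (z + s • Pi.single i 1) (Pi.single i 1)
      - ε * (Real.exp (-K * (q z + 2 * s * d + s ^ 2)) * (-K * (2 * d + 2 * s))), ?_, ?_, ?_⟩
    · intro s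
      have := (c1 s).sub (((hE s).sub_const (Real.exp (-K * R))).const_mul ε)
      simp only [hF, hline]
      exact this
    · simp [hX]
      ring
    · have := c2.sub (hE2.const_mul ε)
      refine this.congr_deriv ?_
      simp
      ring
  have hev : ∀ i, ∀ᶠ s in nhds (0:ℝ), r < q (z + s • Pi.single i 1) ∧ q (z + s • Pi.single i 1) < R := by
    intro i
    have hc : Continuous (fun s : ℝ => q (z + s • Pi.single i 1)) := hqc.comp (by fun_prop)
    have h1 := hc.continuousAt (x := 0) |>.eventually (lt_mem_nhds (a := r) (by simpa using hzr))
    have h2 := hc.continuousAt (x := 0) |>.eventually (gt_mem_nhds (show q (z + (0:ℝ) • Pi.single i 1) < R by simpa using hzR))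
    exact h1.and h2
  have hmem : ∀ i s, r < q (z + s • Pi.single i 1) ∧ q (z + s • Pi.single i 1) < R →
      (b i ≠ 0 → 0 ≤ z i + s) → F z ≤ F (z + s • Pi.single i 1) := by
    intro i s h1 h2
    apply hzmin
    refine ⟨?_, h1.1.le, h1.2.le⟩
    intro j hj
    by_cases hij : j = i
    · subst hij; simpa using h2 hj
    · simpa [hij] using hzD.1 j hj
  have hzpos : ∀ i, b i ≠ 0 → 0 < z i := by
    intro i hbi
    rcases eq_or_lt_of_le (hzD.1 i hbi) with h | h
    swap
    · exact h
    exfalso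
    obtain ⟨f', h1, h2, -⟩ := hder i
    rw [hG1 i hbi, ← h] at h2
    have h3 : f' 0 < 0 := by
      have : 0 < 2 * K * ε * X * p i := by have := hp i hbi; positivity
      rw [h2]; linarith
    have h4 := (h1 0).tendsto_slope_zero_right
    have h5 : 0 ≤ f' 0 := by
      apply ge_of_tendsto h4
      filter_upwards [nhdsWithin_le_nhds (hev i), self_mem_nhdsWithin] with s hs1 hs2
      have hs : (0:ℝ) < s := hs2
      have := hmem i s hs1 (fun _ => by rw [← h]; linarith)
      simp only [zero_add, zero_smul, add_zero, smul_eq_mul]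
      apply mul_nonneg (by positivity)
      linarith
    linarith
  have hterm : ∀ i, ε * X * (4 * K ^ 2 * (z i - p i) ^ 2 - 2 * K * (1 + b i)) ≤
      fderiv ℝ (fderiv ℝ U) z (Pi.single i 1) (Pi.single i 1) + b i * G i z := by
    intro i
    obtain ⟨f', h1, h2, h3⟩ := hder i
    have hmin : IsLocalMin (fun s : ℝ => F (z + s • Pi.single i 1)) 0 := by
      have : ∀ᶠ s in nhds (0:ℝ), b i ≠ 0 → 0 ≤ z i + s := by
        by_cases hbi : b i = 0
        · filter_upwards with s h; exact absurd hbi h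
        · filter_upwards [Ioi_mem_nhds (show -z i < 0 by linarith [hzpos i hbi])] with s hs _
          have : -z i < s := hs
          linarith
      filter_upwards [hev i, this] with s hs1 hs2
      simpa using hmem i s hs1 hs2
    obtain ⟨h4, h5⟩ := lv_min_test h1 h3 hmin
    rw [h2] at h4
    have h6 : -(ε * X * (2 * K * b i)) ≤ b i * G i z := by
      by_cases hbi : b i = 0
      · simp [hbi]
      have hz := hzpos i hbi
      rw [hG1 i hbi] at h4
      have hpi := hp i hbi
      have : -(ε * X * (2 * K)) ≤ G i z := by
        by_contra h
        push Not at h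
        have h7 := mul_lt_mul_of_pos_left h hz
        have h8 : 0 < 2 * K * ε * X * p i := by positivity
        nlinarith
      have := mul_le_mul_of_nonneg_left this (hb i)
      linarith
    linarith
  have hsum := Finset.sum_le_sum (s := Finset.univ) (fun i _ => hterm i)
  have e1 := heq z
  have h1 : ∑ i, ε * X * (4 * K ^ 2 * (z i - p i) ^ 2 - 2 * K * (1 + b i))
      = ε * X * (4 * K ^ 2 * q z - 2 * K * N) := by
    rw [hqs, hN]
    simp only [Finset.mul_sum, ← Finset.sum_sub_distrib]
  rw [h1] at hsum
  have h2 : 0 ≤ U z ^ α := Real.rpow_nonneg (hU0 z) α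
  have h3 : N + 1 < K * q z := by rw [← hKr]; exact mul_lt_mul_of_pos_left hzr hK0
  have h4 : 0 < 4 * K ^ 2 * q z - 2 * K * N := by
    have : 4 * K ^ 2 * q z - 2 * K * N = 2 * K * (2 * (K * q z) - N) := by ring
    rw [this]
    apply mul_pos (by positivity)
    linarith
  have h5 : 0 < ε * X * (4 * K ^ 2 * q z - 2 * K * N) := by positivity
  linarith
end geo

section absU
variable {ι : Type*} [Fintype ι] [DecidableEq ι] {U : (ι → ℝ) → ℝ}

lemma lv_absU [Nonempty ι] (hU : ContDiff ℝ 2 U) {b : ι → ℝ} (hb : ∀ i, 0 ≤ b i) {α N : ℝ}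
    {G : ι → (ι → ℝ) → ℝ} (hUpos : ∀ z, 0 < U z)
    (hG1 : ∀ i, b i ≠ 0 → ∀ z, fderiv ℝ U z (Pi.single i 1) = z i * G i z)
    (hG2 : ∀ i, b i ≠ 0 → ∀ z : ι → ℝ, z i = 0 →
      fderiv ℝ (fderiv ℝ U) z (Pi.single i 1) (Pi.single i 1) = G i z)
    (heq : ∀ z, (∑ i, (fderiv ℝ (fderiv ℝ U) z (Pi.single i 1) (Pi.single i 1)
      + b i * G i z)) + U z ^ α = 0)
    (hN : N = Fintype.card ι + ∑ i, b i) (hN2 : 2 < N) (hα : 1 < α)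
    (hα2 : α * (N - 2) < N + 2) : False := by
  set κ := (N - 2) / 2 with hκ
  have hκ0 : 0 < κ := by rw [hκ]; linarith
  set δ := κ + 2 - α * κ with hδ
  have hδ0 : 0 < δ := by rw [hδ, hκ]; linarith
  set S : Set (ι → ℝ) := {θ | θ ⬝ᵥ θ = 1} with hS
  have hSi : ∀ θ ∈ S, ∀ i, |θ i| ≤ 1 := by
    intro θ hθ i
    have h1 : θ i ^ 2 ≤ 1 := by
      have h2 : ∑ j, θ j ^ 2 = 1 := by
        rw [← (show θ ⬝ᵥ θ = 1 from hθ)]; simp [dotProduct, pow_two]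
      rw [← h2]
      exact Finset.single_le_sum (f := fun i => θ i ^ 2) (fun _ _ => sq_nonneg _)
        (Finset.mem_univ i)
    exact (sq_le_one_iff_abs_le_one _).1 h1
  have hSc : IsCompact S := by
    apply Metric.isCompact_of_isClosed_isBounded
    · exact isClosed_eq (by unfold dotProduct; fun_prop) continuous_const
    · apply (Metric.isBounded_closedBall (x := (0 : ι → ℝ)) (r := 1)).subset
      intro θ hθ
      rw [Metric.mem_closedBall, dist_pi_le_iff (by norm_num)]
      intro i
      simpa [Real.dist_eq] using hSi θ hθ i
  have hSne : S.Nonempty := ⟨Pi.single (Classical.arbitrary ι) 1, by simp [hS]⟩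
  obtain ⟨C, hC⟩ : ∃ C : ℝ, ∀ z ∈ Metric.closedBall (0 : ι → ℝ) 1, U z ≤ C := by
    obtain ⟨C, hC⟩ := (isCompact_closedBall (0 : ι → ℝ) 1).bddAbove_image hU.continuous.continuousOn
    exact ⟨C, fun z hz => hC ⟨z, hz, rfl⟩⟩
  have hC0 : 0 < C := lt_of_lt_of_le (hUpos 0) (hC 0 (by simp))
  have hCb : ∀ t ≤ 0, ∀ θ ∈ S, U (Real.exp t • θ) ≤ C := by
    intro t ht θ hθ
    apply hC
    rw [Metric.mem_closedBall, dist_pi_le_iff (by norm_num)]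
    intro i
    simp only [Pi.smul_apply, smul_eq_mul, Pi.zero_apply, Real.dist_eq, sub_zero, abs_mul,
      Real.abs_exp]
    have h1 := hSi θ hθ i
    have h2 := Real.exp_le_one_iff.2 ht
    have h3 := Real.exp_pos t
    have h4 := abs_nonneg (θ i)
    nlinarith
  set h1 : ℝ → (ι → ℝ) → ℝ := fun t θ => fderiv ℝ U (Real.exp t • θ) (Real.exp t • θ) with hh1
  set h2 : ℝ → (ι → ℝ) → ℝ := fun t θ =>
    fderiv ℝ (fderiv ℝ U) (Real.exp t • θ) (Real.exp t • θ) (Real.exp t • θ)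
      + fderiv ℝ U (Real.exp t • θ) (Real.exp t • θ) with hh2
  have hd : ∀ t θ, HasDerivAt (fun s => U (Real.exp s • θ)) (h1 t θ) t ∧
      HasDerivAt (fun s => h1 s θ) (h2 t θ) t := by
    intro t θ
    have he : ∀ s, HasDerivAt (fun s => Real.exp s • θ) (Real.exp s • θ) s :=
      fun s => (Real.hasDerivAt_exp s).smul_const θ
    obtain ⟨c1, c2⟩ := lv_curve hU (γ := fun s => Real.exp s • θ) he (he t)
    exact ⟨c1 t, c2⟩
  have hexpκ : ∀ t, HasDerivAt (fun s => Real.exp (κ * s)) (κ * Real.exp (κ * t)) t := by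
    intro t
    have : HasDerivAt (fun s => κ * s) κ t := by simpa using (hasDerivAt_id t).const_mul κ
    exact this.exp.congr_deriv (by ring)
  refine lv_cyl (S := S) (V := fun t θ => Real.exp (κ * t) * U (Real.exp t • θ))
    (V1 := fun t θ => Real.exp (κ * t) * (κ * U (Real.exp t • θ) + h1 t θ))
    (V2 := fun t θ => Real.exp (κ * t) * (κ ^ 2 * U (Real.exp t • θ) + 2 * κ * h1 t θ + h2 t θ))
    (κ := κ) (δ := δ) (α := α) hSc hSne hα hδ0 hκ0 ?_ ?_ ?_ ?_ ?_ ?_ ?_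
  · have := hU.continuous
    fun_prop
  · intro t θ
    refine ((hexpκ t).mul (hd t θ).1).congr_deriv ?_
    ring
  · intro t θ
    refine ((hexpκ t).mul (((hd t θ).1.const_mul κ).add (hd t θ).2)).congr_deriv ?_
    simp only [Pi.add_apply]
    ring
  · intro t θ _
    have := hUpos (Real.exp t • θ)
    positivity
  · intro ε hε
    have hlim : Filter.Tendsto (fun t => Real.exp (κ * t) * C) Filter.atBot (nhds 0) := by
      have := (Real.tendsto_exp_atBot.comp
        (Filter.tendsto_id.const_mul_atBot hκ0)).mul_const C
      simpa [Function.comp_def] using this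
    obtain ⟨T, hT⟩ := Filter.eventually_atBot.1
      ((hlim.eventually (gt_mem_nhds hε)).and (Filter.eventually_le_atBot 0))
    refine ⟨T, fun t ht θ hθ => ?_⟩
    obtain ⟨g1, g2⟩ := hT t ht
    have := mul_le_mul_of_nonneg_left (hCb t g2 θ hθ) (Real.exp_pos (κ * t)).le
    linarith
  · intro ε hε
    have hlim : Filter.Tendsto (fun t => α * Real.exp (δ * t) * C ^ (α - 1)) Filter.atBot (nhds 0) := by
      have := ((Real.tendsto_exp_atBot.comp
        (Filter.tendsto_id.const_mul_atBot hδ0)).const_mul α).mul_const (C ^ (α - 1))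
      simpa [Function.comp_def] using this
    obtain ⟨T, hT⟩ := Filter.eventually_atBot.1
      ((hlim.eventually (gt_mem_nhds hε)).and (Filter.eventually_le_atBot 0))
    refine ⟨T, fun t ht θ hθ => ?_⟩
    obtain ⟨g1, g2⟩ := hT t ht
    refine lt_of_le_of_lt ?_ g1
    apply mul_le_mul_of_nonneg_left _ (by positivity)
    have hu := hUpos (Real.exp t • θ)
    apply Real.rpow_le_rpow (by positivity) _ (by linarith)
    have h3 : Real.exp (κ * t) ≤ 1 := Real.exp_le_one_iff.2 (by nlinarith)
    have h4 := hCb t g2 θ hθ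
    nlinarith
  · intro A B t t' θ hθ hmin
    have hst := lv_star hU hb hG1 hG2 heq (A := A * Real.exp (κ * t')) (B := B * Real.exp (κ * t))
      (Real.exp_pos t') (Real.exp_pos t) hθ (by
        intro θ' hθ'
        have := hmin θ' hθ'
        linarith)
    rw [← hN] at hst
    have hX : ∀ t, Real.exp (κ * t) * (κ ^ 2 * U (Real.exp t • θ) + 2 * κ * h1 t θ + h2 t θ)
        - κ ^ 2 * (Real.exp (κ * t) * U (Real.exp t • θ))
        + Real.exp (δ * t) * (Real.exp (κ * t) * U (Real.exp t • θ)) ^ α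
        = Real.exp (κ * t) * (Real.exp t ^ 2 * fderiv ℝ (fderiv ℝ U) (Real.exp t • θ) θ θ
          + (N - 1) * (Real.exp t * fderiv ℝ U (Real.exp t • θ) θ)
          + Real.exp t ^ 2 * U (Real.exp t • θ) ^ α) := by
      intro t
      have e1 : Real.exp (δ * t) * (Real.exp (κ * t) * U (Real.exp t • θ)) ^ α
          = Real.exp (κ * t) * (Real.exp t ^ 2 * U (Real.exp t • θ) ^ α) := by
        rw [Real.mul_rpow (Real.exp_pos _).le (hUpos _).le, ← Real.exp_mul, ← Real.exp_nat_mul,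
          ← mul_assoc, ← mul_assoc, ← Real.exp_add, ← Real.exp_add]
        congr 2
        rw [hδ]
        push_cast
        ring
      rw [e1]
      have hκN : 2 * κ = N - 2 := by rw [hκ]; ring
      simp only [hh1, hh2, map_smul, smul_apply, smul_eq_mul]
      rw [hκN]
      ring
    simp only [hX]
    linarith
end absU

section fin
variable {n m : ℕ}

/-- change of variables -/
noncomputable def lvPhi (n m : ℕ) (z : Fin n ⊕ Fin m → ℝ) : (Fin n → ℝ) × (Fin m → ℝ) :=
  (fun i => z (Sum.inl i), fun j => z (Sum.inr j) ^ 2 / 4)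

lemma lv_setup (av : Fin m → ℝ) (α : ℝ) (hα : 1 < α)
    (u : (Fin n → ℝ) × (Fin m → ℝ) → ℝ)
    (hreg : ContDiffOn ℝ 2 u {p : (Fin n → ℝ) × (Fin m → ℝ) | ∀ i, 0 ≤ p.2 i})
    (heq : ∀ (x : Fin n → ℝ) (y : Fin m → ℝ), (∀ i, 0 < y i) →
      (∑ i, y i * pdyy n m u i x y) + (∑ i, av i * pdy n m u i x y) +
        (∑ i, pdxx n m u i x y) + u (x, y) ^ α = 0) :
    ContDiff ℝ 2 (fun z => u (lvPhi n m z)) ∧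
    ∃ G : Fin n ⊕ Fin m → (Fin n ⊕ Fin m → ℝ) → ℝ,
    (∀ j z, fderiv ℝ (fun z => u (lvPhi n m z)) z (Pi.single (Sum.inr j) 1)
      = z (Sum.inr j) * G (Sum.inr j) z) ∧
    (∀ j z, z (Sum.inr j) = 0 →
      fderiv ℝ (fderiv ℝ (fun z => u (lvPhi n m z))) z (Pi.single (Sum.inr j) 1)
        (Pi.single (Sum.inr j) 1) = G (Sum.inr j) z) ∧
    (∀ z, (∑ i, (fderiv ℝ (fderiv ℝ (fun z => u (lvPhi n m z))) z (Pi.single i 1) (Pi.single i 1)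
      + (Sum.elim (fun _ => 0) (fun j => 2 * av j - 1) i : ℝ) * G i z))
        + u (lvPhi n m z) ^ α = 0) := by
  set O : Set ((Fin n → ℝ) × (Fin m → ℝ)) := {p | ∀ i, 0 ≤ p.2 i} with hO
  have hΦO : ∀ z, lvPhi n m z ∈ O := by
    intro z i
    simp only [lvPhi]
    positivity
  have hΦ : ContDiff ℝ 2 (lvPhi n m) := by
    unfold lvPhi
    fun_prop
  set U : (Fin n ⊕ Fin m → ℝ) → ℝ := fun z => u (lvPhi n m z) with hUdef
  have hU : ContDiff ℝ 2 U := by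
    rw [← contDiffOn_univ]
    exact hreg.comp hΦ.contDiffOn (fun z _ => hΦO z)
  have huniq : UniqueDiffOn ℝ O := by
    have : O = Set.univ ×ˢ (Set.pi Set.univ fun _ : Fin m => Set.Ici (0:ℝ)) := by
      ext p; simp [hO, Pi.le_def]
    rw [this]
    exact uniqueDiffOn_univ.prod (UniqueDiffOn.univ_pi fun _ => uniqueDiffOn_Ici 0)
  set G : Fin n ⊕ Fin m → (Fin n ⊕ Fin m → ℝ) → ℝ := fun i z =>
    Sum.elim (fun _ => 0)
      (fun j => fderivWithin ℝ u O (lvPhi n m z) (0, Pi.single j 1) / 2) i with hG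
  have hGc : ∀ i, Continuous (G i) := by
    rintro (i | j)
    · simp only [hG, Sum.elim_inl]; exact continuous_const
    · simp only [hG, Sum.elim_inr]
      have h1 := hreg.continuousOn_fderivWithin huniq (by norm_num)
      have h2 : Continuous (fun z => fderivWithin ℝ u O (lvPhi n m z)) :=
        h1.comp_continuous hΦ.continuous hΦO
      exact (h2.clm_apply continuous_const).div_const 2
  -- line derivative facts
  have hl : ∀ (z : Fin n ⊕ Fin m → ℝ) i (s : ℝ),
      HasDerivAt (fun s : ℝ => z + s • (Pi.single i 1 : Fin n ⊕ Fin m → ℝ)) (Pi.single i 1) s := by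
    intro z i s
    have := ((hasDerivAt_id s).smul_const (Pi.single i (1:ℝ) : Fin n ⊕ Fin m → ℝ)).const_add z
    simpa using this
  have hline : ∀ (z : Fin n ⊕ Fin m → ℝ) i,
      (∀ s, HasDerivAt (fun s : ℝ => U (z + s • Pi.single i 1))
        (fderiv ℝ U (z + s • Pi.single i 1) (Pi.single i 1)) s) ∧
      HasDerivAt (fun s : ℝ => fderiv ℝ U (z + s • Pi.single i 1) (Pi.single i 1))
        (fderiv ℝ (fderiv ℝ U) z (Pi.single i 1) (Pi.single i 1)) 0 := by
    intro z i
    obtain ⟨c1, c2⟩ := lv_curve hU (γ := fun s : ℝ => z + s • (Pi.single i 1 : Fin n ⊕ Fin m → ℝ))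
      (γ1 := fun _ => Pi.single i 1) (γ2 := 0) (t := 0) (hl z i) (hasDerivAt_const _ _)
    exact ⟨c1, by simpa using c2⟩
  have hG1 : ∀ j z, fderiv ℝ U z (Pi.single (Sum.inr j) 1) = z (Sum.inr j) * G (Sum.inr j) z := by
    intro j z
    have h1 := (hline z (Sum.inr j)).1 0
    simp only [zero_smul, add_zero] at h1
    have h2 : HasDerivAt (fun s : ℝ => lvPhi n m (z + s • Pi.single (Sum.inr j) 1))
        ((0, (z (Sum.inr j) / 2) • Pi.single j 1) : (Fin n → ℝ) × (Fin m → ℝ)) 0 := by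
      unfold lvPhi
      refine HasDerivAt.prodMk ?_ ?_
      · have : (fun s : ℝ => fun i => (z + s • (Pi.single (Sum.inr j) 1 : Fin n ⊕ Fin m → ℝ)) (Sum.inl i))
            = fun _ => fun i => z (Sum.inl i) := by
          ext s i; simp
        rw [this]
        exact hasDerivAt_const _ _
      · rw [hasDerivAt_pi]
        intro k
        by_cases hk : k = j
        · subst hk
          have h3 : HasDerivAt (fun s : ℝ => (z (Sum.inr k) + s) ^ 2 / 4)
              (z (Sum.inr k) / 2) 0 := by
            have := ((((hasDerivAt_id (0:ℝ)).const_add (z (Sum.inr k))).pow 2).div_const 4)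
            refine this.congr_deriv ?_
            simp
            ring
          simpa using h3
        · simpa [hk] using hasDerivAt_const (0:ℝ) (z (Sum.inr k) ^ 2 / 4)
    have hdw : HasFDerivWithinAt u (fderivWithin ℝ u O (lvPhi n m z)) O (lvPhi n m z) :=
      ((hreg.differentiableOn (by norm_num)) _ (hΦO z)).hasFDerivWithinAt
    have h4 := HasFDerivWithinAt.comp_hasDerivAt_of_eq (f := fun s : ℝ => lvPhi n m (z + s • Pi.single (Sum.inr j) 1)) (0:ℝ) hdw h2
      (Filter.Eventually.of_forall fun s => hΦO _) (by simp)
    have h5 := h1.unique h4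
    rw [h5]
    have : ((0, (z (Sum.inr j) / 2) • Pi.single j 1) : (Fin n → ℝ) × (Fin m → ℝ))
        = (z (Sum.inr j) / 2) • (0, Pi.single j 1) := by simp
    rw [this, map_smul]
    simp only [hG, Sum.elim_inr, smul_eq_mul]
    ring
  have hGint : ∀ z : Fin n ⊕ Fin m → ℝ, (∀ j, z (Sum.inr j) ≠ 0) →
      (∑ i, (fderiv ℝ (fderiv ℝ U) z (Pi.single i 1) (Pi.single i 1)
      + (Sum.elim (fun _ => 0) (fun j => 2 * av j - 1) i : ℝ) * G i z)) + U z ^ α = 0 := by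
    intro z hz
    set x : Fin n → ℝ := fun i => z (Sum.inl i) with hx
    set y : Fin m → ℝ := fun j => z (Sum.inr j) ^ 2 / 4 with hy
    have hy0 : ∀ j, 0 < y j := by
      intro j
      have := hz j
      simp only [hy]
      positivity
    have hΦz : lvPhi n m z = (x, y) := rfl
    have hE := heq x y hy0
    rw [Fintype.sum_sum_type]
    simp only [Sum.elim_inl, Sum.elim_inr, zero_mul, add_zero]
    have hxx : ∀ i, fderiv ℝ (fderiv ℝ U) z (Pi.single (Sum.inl i) 1) (Pi.single (Sum.inl i) 1)
        = pdxx n m u i x y := by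
      intro i
      obtain ⟨c1, c2⟩ := hline z (Sum.inl i)
      have e1 : ∀ s, u (Function.update x i s, y)
          = U (z + (s - x i) • Pi.single (Sum.inl i) 1) := by
        intro s
        simp only [hUdef]
        congr 1
        unfold lvPhi
        ext k
        · by_cases hk : k = i
          · subst hk; simp [hx]
          · simp [hk, hx]
        · simp [hy]
      have e2 : ∀ t, HasDerivAt (fun s => u (Function.update x i s, y))
          (fderiv ℝ U (z + (t - x i) • Pi.single (Sum.inl i) 1) (Pi.single (Sum.inl i) 1)) t := by
        intro t
        simp only [e1]
        exact HasDerivAt.comp_sub_const t (x i) (c1 (t - x i))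
      have e3 : HasDerivAt (fun t => deriv (fun s => u (Function.update x i s, y)) t)
          (fderiv ℝ (fderiv ℝ U) z (Pi.single (Sum.inl i) 1) (Pi.single (Sum.inl i) 1)) (x i) := by
        have : (fun t => deriv (fun s => u (Function.update x i s, y)) t)
            = fun t => fderiv ℝ U (z + (t - x i) • Pi.single (Sum.inl i) 1) (Pi.single (Sum.inl i) 1) :=
          funext fun t => (e2 t).deriv
        rw [this]
        have c3 : HasDerivAt (fun s : ℝ => fderiv ℝ U (z + s • (Pi.single (Sum.inl i) 1 : Fin n ⊕ Fin m → ℝ))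
            (Pi.single (Sum.inl i) 1))
            (fderiv ℝ (fderiv ℝ U) z (Pi.single (Sum.inl i) 1) (Pi.single (Sum.inl i) 1)) (x i - x i) := by
          rw [sub_self]
          exact c2
        exact HasDerivAt.comp_sub_const (x i) (x i) c3
      exact e3.deriv.symm
    have hyy : ∀ j, fderiv ℝ (fderiv ℝ U) z (Pi.single (Sum.inr j) 1) (Pi.single (Sum.inr j) 1)
        + (2 * av j - 1) * G (Sum.inr j) z = y j * pdyy n m u j x y + av j * pdy n m u j x y := by
      intro j
      obtain ⟨c1, c2⟩ := hline z (Sum.inr j)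
      set zj := z (Sum.inr j) with hzj
      have hzj0 : zj ≠ 0 := hz j
      set g : ℝ → ℝ := fun t => u (x, Function.update y j t) with hg
      have hgc : ContDiffOn ℝ 2 g (Set.Ioi 0) := by
        apply hreg.comp (t := O)
        · have : ContDiff ℝ 2 (fun t : ℝ => (x, Function.update y j t)) := by
            apply ContDiff.prodMk contDiff_const
            exact contDiff_update 2 y j
          exact this.contDiffOn
        · intro t ht k
          by_cases hk : k = j
          · subst hk; simpa using (le_of_lt ht)
          · simpa [hk] using (hy0 k).le
      have hg1 : ∀ t > 0, HasDerivAt g (deriv g t) t := by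
        intro t ht
        exact ((hgc.differentiableOn (by norm_num)).differentiableAt (Ioi_mem_nhds ht)).hasDerivAt
      have hg2 : HasDerivAt (deriv g) (deriv (deriv g) (y j)) (y j) := by
        have h := (contDiffOn_succ_iff_deriv_of_isOpen (n := 1) isOpen_Ioi).1
          (by simpa [one_add_one_eq_two] using hgc)
        exact ((h.2.2.differentiableOn (by norm_num)).differentiableAt
          (Ioi_mem_nhds (hy0 j))).hasDerivAt
      have hUg : ∀ s, U (z + s • Pi.single (Sum.inr j) 1) = g ((zj + s) ^ 2 / 4) := by
        intro s
        simp only [hUdef, hg]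
        congr 1
        unfold lvPhi
        ext k
        · simp [hx]
        · by_cases hk : k = j
          · subst hk; simp [hzj]
          · simp [hk, hy]
      have hq : ∀ s, HasDerivAt (fun s : ℝ => (zj + s) ^ 2 / 4) ((zj + s) / 2) s := by
        intro s
        have := ((((hasDerivAt_id s).const_add zj).pow 2).div_const 4)
        refine this.congr_deriv ?_
        simp
        ring
      have hnear : ∀ᶠ s in nhds (0:ℝ), zj + s ≠ 0 := by
        have : ContinuousAt (fun s : ℝ => zj + s) 0 := by fun_prop
        exact this.eventually_ne (by simpa using hzj0)
      have hfst : ∀ s, zj + s ≠ 0 → fderiv ℝ U (z + s • Pi.single (Sum.inr j) 1) (Pi.single (Sum.inr j) 1)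
          = deriv g ((zj + s) ^ 2 / 4) * ((zj + s) / 2) := by
        intro s hs
        have h1 := c1 s
        simp only [hUg] at h1
        have h2 := (hg1 ((zj + s) ^ 2 / 4) (by positivity)).comp s (hq s)
        exact h1.unique h2
      have hyj : y j = zj ^ 2 / 4 := rfl
      have hsnd : fderiv ℝ (fderiv ℝ U) z (Pi.single (Sum.inr j) 1) (Pi.single (Sum.inr j) 1)
          = deriv (deriv g) (y j) * (zj / 2) * (zj / 2) + deriv g (y j) / 2 := by
        have h1 : HasDerivAt (fun s => deriv g ((zj + s) ^ 2 / 4))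
            (deriv (deriv g) (y j) * (zj / 2)) 0 := by
          have := HasDerivAt.comp_of_eq (0:ℝ) hg2 (hq 0) (by simp [hyj])
          simpa [Function.comp_def] using this
        have h2 : HasDerivAt (fun s : ℝ => (zj + s) / 2) (1 / 2) 0 := by
          simpa using ((hasDerivAt_id (0:ℝ)).const_add zj).div_const 2
        have h3 := h1.mul h2
        have h4 := h3.congr_of_eventuallyEq (f₁ := fun s : ℝ =>
            fderiv ℝ U (z + s • Pi.single (Sum.inr j) 1) (Pi.single (Sum.inr j) 1)) (by
          filter_upwards [hnear] with s hs
          exact hfst s hs)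
        rw [c2.unique h4]
        simp only [add_zero, hyj]
        ring
      have hGj : G (Sum.inr j) z = deriv g (y j) / 2 := by
        have h1 := hfst 0 (by simpa using hzj0)
        simp only [zero_smul, add_zero] at h1
        rw [hG1] at h1
        apply mul_left_cancel₀ hzj0
        rw [h1, hyj]
        ring
      have hp1 : pdy n m u j x y = deriv g (y j) := rfl
      have hp2 : pdyy n m u j x y = deriv (deriv g) (y j) := rfl
      rw [hsnd, hGj, hp1, hp2]
      rw [show y j * deriv (deriv g) (y j) = zj ^ 2 / 4 * deriv (deriv g) (y j) from rfl]
      ring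
    simp only [hxx, hyy, Finset.sum_add_distrib]
    have : U z = u (x, y) := rfl
    rw [this]
    linarith
  refine ⟨hU, G, hG1, ?_, ?_⟩
  · intro j z hz
    have c2 := (hline z (Sum.inr j)).2
    simp only [hG1] at c2
    have h3 : HasDerivAt (fun s : ℝ => (z + s • (Pi.single (Sum.inr j) 1 : Fin n ⊕ Fin m → ℝ)) (Sum.inr j)
        * G (Sum.inr j) (z + s • Pi.single (Sum.inr j) 1)) (G (Sum.inr j) z) 0 := by
      rw [hasDerivAt_iff_tendsto_slope_zero]
      have hc : Continuous (fun s : ℝ => G (Sum.inr j) (z + s • (Pi.single (Sum.inr j) 1 : Fin n ⊕ Fin m → ℝ))) :=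
        (hGc (Sum.inr j)).comp (f := fun s : ℝ => z + s • (Pi.single (Sum.inr j) 1 : Fin n ⊕ Fin m → ℝ)) (by fun_prop)
      have h4 : Filter.Tendsto (fun s : ℝ => G (Sum.inr j) (z + s • (Pi.single (Sum.inr j) 1 : Fin n ⊕ Fin m → ℝ)))
          (nhdsWithin 0 {0}ᶜ) (nhds (G (Sum.inr j) z)) := by
        have := (hc.tendsto 0).mono_left (nhdsWithin_le_nhds (s := {0}ᶜ))
        simpa using this
      refine h4.congr' ?_
      filter_upwards [self_mem_nhdsWithin] with s hs
      have hs0 : s ≠ 0 := hs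
      simp [hz]
      field_simp
    exact c2.unique h3
  · intro z
    set Q : (Fin n ⊕ Fin m → ℝ) → ℝ := fun z =>
      (∑ i, (fderiv ℝ (fderiv ℝ U) z (Pi.single i 1) (Pi.single i 1)
      + (Sum.elim (fun _ => 0) (fun j => 2 * av j - 1) i : ℝ) * G i z)) + U z ^ α with hQ
    have hHc : Continuous (fderiv ℝ (fderiv ℝ U)) :=
      (hU.fderiv_right (m := 1) (by norm_num)).continuous_fderiv (by norm_num)
    have hQc : Continuous Q := by
      apply Continuous.add
      · apply continuous_finsetSum
        intro i _
        exact ((hHc.clm_apply continuous_const).clm_apply continuous_const).add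
          (continuous_const.mul (hGc i))
      · exact hU.continuous.rpow_const (fun _ => Or.inr (by linarith))
    have hc : Continuous (fun s : ℝ => Q (z + s • (fun _ => 1))) := hQc.comp (by fun_prop)
    have hlim : Filter.Tendsto (fun s : ℝ => Q (z + s • (fun _ => 1)))
        (nhdsWithin 0 {0}ᶜ) (nhds (Q z)) := by
      have := (hc.tendsto 0).mono_left (nhdsWithin_le_nhds (s := {0}ᶜ))
      simpa using this
    have hev : ∀ᶠ s in nhdsWithin (0:ℝ) {0}ᶜ, Q (z + s • (fun _ => 1)) = 0 := by
      have : ∀ᶠ s in nhdsWithin (0:ℝ) {0}ᶜ, ∀ j, (z + s • (fun _ => 1 : Fin n ⊕ Fin m → ℝ)) (Sum.inr j) ≠ 0 := by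
        rw [Filter.eventually_all]
        intro j
        by_cases h0 : z (Sum.inr j) = 0
        · filter_upwards [self_mem_nhdsWithin] with s hs
          simpa [h0] using hs
        · apply nhdsWithin_le_nhds
          have : ContinuousAt (fun s : ℝ => (z + s • (fun _ => 1 : Fin n ⊕ Fin m → ℝ)) (Sum.inr j)) 0 := by
            simp only [Pi.add_apply, Pi.smul_apply]
            fun_prop
          exact this.eventually_ne (by simpa using h0)
      filter_upwards [this] with s hs
      exact hGint _ hs
    exact tendsto_nhds_unique (hlim.congr' hev) tendsto_const_nhds
end fin

/-- Theorem 3.1(1): subcritical Liouville theorem for the equation with several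
degenerate directions `Σ yᵢ u_{yᵢyᵢ} + Σ aᵢ u_{yᵢ} + Δₓ u + u^α = 0`. -/
theorem liouville_subcritical_multi (n m : ℕ) (hn : 1 ≤ n) (hm : 1 ≤ m)
    (av : Fin m → ℝ) (hav : ∀ i, 1 < av i) (a : ℝ) (hA : a = ∑ i, av i)
    (α : ℝ) (hα₁ : 1 < α) (hα₂ : α < (n + 2 * a + 2) / (n + 2 * a - 2))
    (u : (Fin n → ℝ) × (Fin m → ℝ) → ℝ)
    (hreg : ContDiffOn ℝ 2 u {p : (Fin n → ℝ) × (Fin m → ℝ) | ∀ i, 0 ≤ p.2 i})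
    (hnonneg : ∀ (x : Fin n → ℝ) (y : Fin m → ℝ), (∀ i, 0 ≤ y i) → 0 ≤ u (x, y))
    (heq : ∀ (x : Fin n → ℝ) (y : Fin m → ℝ), (∀ i, 0 < y i) →
      (∑ i, y i * pdyy n m u i x y) + (∑ i, av i * pdy n m u i x y) +
        (∑ i, pdxx n m u i x y) + u (x, y) ^ α = 0) :
    ∀ (x : Fin n → ℝ) (y : Fin m → ℝ), (∀ i, 0 ≤ y i) → u (x, y) = 0 := by
  intro x y hy
  by_contra hne
  have hpos : 0 < u (x, y) := lt_of_le_of_ne (hnonneg x y hy) (Ne.symm hne)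
  obtain ⟨hU, G, hG1, hG2, hE⟩ := lv_setup av α hα₁ u hreg heq
  set U : (Fin n ⊕ Fin m → ℝ) → ℝ := fun z => u (lvPhi n m z) with hUdef
  set b : Fin n ⊕ Fin m → ℝ := Sum.elim (fun _ => 0) (fun j => 2 * av j - 1) with hb
  have hb0 : ∀ i, 0 ≤ b i := by
    rintro (i | j)
    · simp [hb]
    · have := hav j
      simp only [hb, Sum.elim_inr]
      linarith
  have hU0 : ∀ z, 0 ≤ U z := fun z => hnonneg _ _ (fun i => by positivity)
  have hG1' : ∀ i, b i ≠ 0 → ∀ z, fderiv ℝ U z (Pi.single i 1) = z i * G i z := by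
    rintro (i | j) h z
    · simp [hb] at h
    · exact hG1 j z
  have hG2' : ∀ i, b i ≠ 0 → ∀ z : Fin n ⊕ Fin m → ℝ, z i = 0 →
      fderiv ℝ (fderiv ℝ U) z (Pi.single i 1) (Pi.single i 1) = G i z := by
    rintro (i | j) h z hz
    · simp [hb] at h
    · exact hG2 j z hz
  -- a point with positive coordinates where U > 0
  set z0 : Fin n ⊕ Fin m → ℝ := Sum.elim x (fun j => 2 * Real.sqrt (y j)) with hz0
  have hUz0 : 0 < U z0 := by
    have : lvPhi n m z0 = (x, y) := by
      unfold lvPhi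
      ext k
      · simp [hz0]
      · simp only [hz0, Sum.elim_inr, mul_pow, Real.sq_sqrt (hy k)]
        ring
    simp only [hUdef, this]
    exact hpos
  obtain ⟨s, hs0, hs⟩ : ∃ s : ℝ, 0 < s ∧ 0 < U (z0 + s • (fun _ => 1)) := by
    have hc : Continuous (fun s : ℝ => U (z0 + s • (fun _ => 1))) := hU.continuous.comp (by fun_prop)
    have h1 := hc.continuousAt (x := 0) |>.eventually (lt_mem_nhds (a := 0) (by simpa using hUz0))
    have h2 : ∀ᶠ s in nhdsWithin (0:ℝ) (Set.Ioi 0), 0 < U (z0 + s • (fun _ => 1)) :=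
      h1.filter_mono nhdsWithin_le_nhds
    obtain ⟨s, h3, h4⟩ := (h2.and self_mem_nhdsWithin).exists
    exact ⟨s, h4, h3⟩
  have hUpos : ∀ z, 0 < U z := by
    intro z
    have h1 := lv_pos hU hb0 hU0 hG1' hE (z0 + s • (fun _ => 1)) (by
      rintro (i | j) h
      · simp [hb] at h
      · have := Real.sqrt_nonneg (y j)
        simp only [hz0, Pi.add_apply, Sum.elim_inr, Pi.smul_apply, smul_eq_mul, mul_one]
        linarith) hs (Sum.elim (fun i => z (Sum.inl i)) (fun j => |z (Sum.inr j)|)) (by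
      rintro (i | j) h
      · simp [hb] at h
      · simp)
    have h2 : lvPhi n m (Sum.elim (fun i => z (Sum.inl i)) (fun j => |z (Sum.inr j)|))
        = lvPhi n m z := by
      unfold lvPhi
      simp
    simp only [hUdef] at h1 ⊢
    rwa [h2] at h1
  haveI : Nonempty (Fin n ⊕ Fin m) := ⟨Sum.inl ⟨0, hn⟩⟩
  have ha1 : (m : ℝ) ≤ a := by
    rw [hA]
    have := Finset.sum_le_sum (s := Finset.univ) (fun i (_ : i ∈ Finset.univ) => (hav i).le)
    simpa using this
  have hm1 : (1:ℝ) ≤ m := by exact_mod_cast hm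
  have hn1 : (1:ℝ) ≤ n := by exact_mod_cast hn
  refine lv_absU (N := n + 2 * a) hU hb0 hUpos hG1' hG2' hE ?_ (by linarith) hα₁ ?_
  · rw [Fintype.sum_sum_type]
    simp only [hb, Sum.elim_inl, Sum.elim_inr, Finset.sum_const_zero, Finset.sum_sub_distrib,
      ← Finset.mul_sum, ← hA]
    simp
  · rwa [lt_div_iff₀ (by linarith)] at hα₂
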